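/- Let A, B ⊂ ℝ be sets of one-dimensional Lebesgue measure zero. Then the product A × B ⊂ ℝ² is purely 1-unrectifiable. -/

import Mathlib

open MeasureTheory Set Metric

/-- A set `A ⊆ ℝ²` is purely `1`-unrectifiable if `H¹ (A ∩ f(ℝ)) = 0` for every
Lipschitz map `f : ℝ → ℝ²`. -/
def PurelyOneUnrectifiable (A : Set (EuclideanSpace ℝ (Fin 2))) : Prop :=
  ∀ f : ℝ → EuclideanSpace ℝ (Fin 2),
    (∃ K : NNReal, LipschitzWith K f) → μH[1] (A ∩ Set.range f) = 0

open scoped NNReal ENNReal Function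

section HausdorffDerivative

variable {F : Type*} [NormedAddCommGroup F] [NormedSpace ℝ F] [SecondCountableTopology F]
  [MeasurableSpace F] [BorelSpace F]

theorem hausdorffMeasure_image_le_mul_of_hasDerivAt_zero {f : ℝ → F} {s : Set ℝ}
    (hf : ∀ x ∈ s, HasDerivAt f 0 x) {ε : ℝ≥0} (hε : ε ≠ 0) :
    μH[1] (f '' s) ≤ ε * volume s := by
  rcases s.eq_empty_or_nonempty with rfl | hs
  · simp
  obtain ⟨t, A, t_disj, t_meas, t_cover, ht, hA⟩ :=
    exists_partition_approximatesLinearOn_of_hasFDerivWithinAt f s (fun _ => 0)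
      (fun x hx => by simpa using (hf x hx).hasFDerivAt.hasFDerivWithinAt) (fun _ => ε)
      (fun _ => hε)
  have hlip : ∀ n, LipschitzOnWith ε f (s ∩ t n) := fun n => by
    obtain ⟨_, -, hAn⟩ := hA hs n
    simpa [hAn] using (ht n).lipschitzOnWith
  calc
    μH[1] (f '' s) = μH[1] (⋃ n, f '' (s ∩ t n)) := by
      rw [← image_iUnion, ← inter_iUnion, inter_eq_left.2 t_cover]
    _ ≤ ∑' n, μH[1] (f '' (s ∩ t n)) := measure_iUnion_le _
    _ ≤ ∑' n, ε * volume (s ∩ t n) := by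
      gcongr with n
      simpa [hausdorffMeasure_real] using (hlip n).hausdorffMeasure_image_le zero_le_one
    _ = ε * ∑' n, volume.restrict s (t n) := by
      rw [ENNReal.tsum_mul_left]
      simp only [Measure.restrict_apply (t_meas _), inter_comm]
    _ = ε * volume.restrict s (⋃ n, t n) := by rw [measure_iUnion t_disj t_meas]
    _ ≤ ε * volume s := by
      grw [subset_univ (⋃ n, t n), Measure.restrict_apply_univ]

/-- A Sard lemma for curves: the image of a set of critical points is `H¹`-null. -/
theorem hausdorffMeasure_image_eq_zero_of_hasDerivAt_zero {f : ℝ → F} {s : Set ℝ}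
    (hf : ∀ x ∈ s, HasDerivAt f 0 x) : μH[1] (f '' s) = 0 := by
  rw [← iUnion_inter_closedBall_nat s 0, image_iUnion, measure_iUnion_null_iff]
  intro n
  have hfin : volume (s ∩ closedBall 0 (n : ℝ)) ≠ ∞ :=
    measure_ne_top_of_subset inter_subset_right measure_closedBall_lt_top.ne
  refine le_antisymm (ENNReal.le_of_forall_pos_le_add fun ε hε _ => ?_) zero_le
  obtain ⟨δ, hδ, hδε⟩ := ENNReal.exists_nnreal_pos_mul_lt hfin (ENNReal.coe_ne_zero.2 hε.ne')
  rw [zero_add]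
  exact (hausdorffMeasure_image_le_mul_of_hasDerivAt_zero
    (fun x hx => hf x hx.1) hδ.ne').trans hδε.le

/-- A set on which a curve has nonzero derivative is Lebesgue null if its image is `H¹`-null. -/
theorem volume_eq_zero_of_hausdorffMeasure_image_eq_zero {f f' : ℝ → F} {s : Set ℝ}
    (hf : ∀ x ∈ s, HasDerivAt f (f' x) x) (hf' : ∀ x ∈ s, f' x ≠ 0)
    (h : μH[1] (f '' s) = 0) : volume s = 0 := by
  classical
  rcases s.eq_empty_or_nonempty with rfl | hs
  · simp
  obtain ⟨t, A, -, -, t_cover, ht, hA⟩ :=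
    exists_partition_approximatesLinearOn_of_hasFDerivWithinAt f s
      (fun x => ContinuousLinearMap.toSpanSingleton ℝ (f' x))
      (fun x hx => (hf x hx).hasFDerivAt.hasFDerivWithinAt)
      (fun L => if L = 0 then 1 else ‖L 1‖₊ / 2)
      (fun L => by
        split_ifs with hL
        · exact one_ne_zero
        · have : L 1 ≠ 0 := fun h1 => hL (by ext; simpa using h1)
          simpa using this)
  rw [← inter_eq_left.2 t_cover, inter_iUnion, measure_iUnion_null_iff]
  intro n
  obtain ⟨y, hy, hAn⟩ := hA hs n
  have hc : 0 < ‖f' y‖ := norm_pos_iff.2 (hf' y hy)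
  have hL : ContinuousLinearMap.toSpanSingleton ℝ (f' y) ≠ 0 := fun h0 =>
    hf' y hy (by simpa using congrArg (fun L : ℝ →L[ℝ] F => L 1) h0)
  have happrox := ht n
  simp only [hAn, hL, if_false, ContinuousLinearMap.toSpanSingleton_apply_one] at happrox
  have hanti : AntilipschitzWith (‖f' y‖₊ / 2)⁻¹ ((s ∩ t n).domRestrict f) := by
    refine AntilipschitzWith.of_le_mul_dist fun a b => ?_
    have hab := happrox a.1 a.2 b.1 b.2
    have htri := norm_sub_norm_le (((a : ℝ) - b) • f' y) (f a - f b)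
    rw [norm_sub_rev (((a : ℝ) - b) • f' y), norm_smul] at htri
    simp only [ContinuousLinearMap.toSpanSingleton_apply] at hab
    push_cast at hab ⊢
    rw [inv_mul_eq_div, le_div_iff₀ (half_pos hc), Subtype.dist_eq, dist_eq_norm, dist_eq_norm]
    simp only [domRestrict_apply]
    linarith
  have himage := hanti.le_hausdorffMeasure_image zero_le_one univ
  rw [image_univ, range_domRestrict, measure_mono_null (image_mono inter_subset_left) h, mul_zero,
    ← isometry_subtype_coe.hausdorffMeasure_image (Or.inl zero_le_one), image_univ,
    Subtype.range_coe, hausdorffMeasure_real] at himage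
  exact le_antisymm himage zero_le

end HausdorffDerivative

theorem volume_setOf_deriv_ne_zero_inter_preimage_eq_zero (g : ℝ → ℝ) {A : Set ℝ}
    (hA : volume A = 0) : volume {t | deriv g t ≠ 0 ∧ g t ∈ A} = 0 := by
  refine volume_eq_zero_of_hausdorffMeasure_image_eq_zero (f := g) (f' := deriv g)
    (fun t ht => (differentiableAt_of_deriv_ne_zero ht.1).hasDerivAt) (fun t ht => ht.1) ?_
  rw [hausdorffMeasure_real]
  exact measure_mono_null (image_subset_iff.2 fun t ht => ht.2) hA

/-- If `A, B ⊆ ℝ` are Lebesgue null, then `A × B ⊆ ℝ²` is purely `1`-unrectifiable. -/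
theorem prod_null_purely_unrectifiable (A B : Set ℝ)
    (hA : volume A = 0) (hB : volume B = 0) :
    PurelyOneUnrectifiable {x : EuclideanSpace ℝ (Fin 2) | x 0 ∈ A ∧ x 1 ∈ B} := by
  rintro f ⟨K, hf⟩
  have hcrit : μH[1] (f '' {t | HasDerivAt f 0 t}) = 0 :=
    hausdorffMeasure_image_eq_zero_of_hasDerivAt_zero fun _ ht => ht
  have hnull : volume ({t | ¬ DifferentiableAt ℝ f t} ∪
      ({t | deriv (fun u => f u 0) t ≠ 0 ∧ f t 0 ∈ A} ∪
        {t | deriv (fun u => f u 1) t ≠ 0 ∧ f t 1 ∈ B})) = 0 :=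
    measure_union_null (ae_iff.1 hf.ae_differentiableAt) <| measure_union_null
      (volume_setOf_deriv_ne_zero_inter_preimage_eq_zero _ hA)
      (volume_setOf_deriv_ne_zero_inter_preimage_eq_zero _ hB)
  have himage := hf.hausdorffMeasure_image_le zero_le_one _ |>.trans_eq
    (by rw [hausdorffMeasure_real, hnull, mul_zero])
  refine measure_mono_null ?_ (measure_union_null hcrit (le_antisymm himage zero_le))
  rintro _ ⟨⟨h0, h1⟩, t, rfl⟩
  rw [← image_union]
  refine mem_image_of_mem f ?_
  by_cases hd : DifferentiableAt ℝ f t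
  · by_cases d0 : deriv (fun u => f u 0) t = 0
    · by_cases d1 : deriv (fun u => f u 1) t = 0
      · have hcoord : ∀ i, deriv f t i = deriv (fun u => f u i) t := fun i =>
          ((EuclideanSpace.proj (𝕜 := ℝ) i).hasFDerivAt.comp_hasDerivAt t
            hd.hasDerivAt).deriv.symm
        have hzero : deriv f t = 0 := by
          ext i
          fin_cases i
          · exact (hcoord 0).trans d0
          · exact (hcoord 1).trans d1
        exact Or.inl (hzero ▸ hd.hasDerivAt)
      · exact Or.inr (Or.inr (Or.inr ⟨d1, h1⟩))
    · exact Or.inr (Or.inr (Or.inl ⟨d0, h0⟩))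
  · exact Or.inr (Or.inl hd)
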